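/- The cyclic peak number cpk is cyclic shuffle-compatible: if π, σ are disjoint permutations, π′, σ′ are disjoint permutations, |π| = |π′|, |σ| = |σ′|, cpk[π] = cpk[π′], and cpk[σ] = cpk[σ′], then the multiset {{cpk[τ] : [τ] ∈ [π] ⧢ [σ]}}, where [τ] ranges over the set of cyclic shuffles of [π] and [σ] (each cyclic shuffle counted once), equals the multiset {{cpk[τ] : [τ] ∈ [π′] ⧢ [σ′]}}. -/

import Mathlib

/-- A permutation: a list of distinct positive integers. -/
def IsPerm (π : List ℕ) : Prop := π.Nodup ∧ ∀ x ∈ π, 0 < x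

/-- The descent set `Des π = {i ∈ {1,…,n−1} : π_i > π_{i+1}}` (1-based indexing). -/
def Des (π : List ℕ) : Finset ℕ :=
  (Finset.Icc 1 (π.length - 1)).filter fun i => π.getD i 0 < π.getD (i - 1) 0

/-- The descent number. -/
def des (π : List ℕ) : ℕ := (Des π).card

/-- The major index. -/
def maj (π : List ℕ) : ℕ := ∑ i ∈ Des π, i

/-- The cyclic descent set `cDes π = {i ∈ {1,…,n} : π_i > π_{i+1}}`, indices mod `n`. -/
def cDes (π : List ℕ) : Finset ℕ :=
  (Finset.Icc 1 π.length).filter fun i => π.getD (i % π.length) 0 < π.getD (i - 1) 0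

/-- The cyclic descent number. -/
def cdes (π : List ℕ) : ℕ := (cDes π).card

/-- The cyclic major index. -/
def cmaj (π : List ℕ) : ℕ := ∑ i ∈ cDes π, i

/-- The peak set `Pk π = {i ∈ {2,…,n−1} : π_{i−1} < π_i > π_{i+1}}` (1-based indexing). -/
def Pk (π : List ℕ) : Finset ℕ :=
  (Finset.Icc 2 (π.length - 1)).filter fun i =>
    π.getD (i - 2) 0 < π.getD (i - 1) 0 ∧ π.getD i 0 < π.getD (i - 1) 0

/-- The peak number. -/
def pk (π : List ℕ) : ℕ := (Pk π).card

/-- The cyclic peak set `cPk π = {i ∈ {1,…,n} : π_{i−1} < π_i > π_{i+1}}`, indices mod `n`. -/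
def cPk (π : List ℕ) : Finset ℕ :=
  (Finset.Icc 1 π.length).filter fun i =>
    π.getD ((i + π.length - 2) % π.length) 0 < π.getD (i - 1) 0 ∧
      π.getD (i % π.length) 0 < π.getD (i - 1) 0

/-- The cyclic peak number. -/
def cpk (π : List ℕ) : ℕ := (cPk π).card

/-- The cyclic valley set `cVal π = {i ∈ {1,…,n} : π_{i−1} > π_i < π_{i+1}}`, indices mod `n`. -/
def cVal (π : List ℕ) : Finset ℕ :=
  (Finset.Icc 1 π.length).filter fun i =>
    π.getD (i - 1) 0 < π.getD ((i + π.length - 2) % π.length) 0 ∧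
      π.getD (i - 1) 0 < π.getD (i % π.length) 0

/-- The cyclic valley number. -/
def cval (π : List ℕ) : ℕ := (cVal π).card

/-- The distribution of a linear statistic `st` over the `n` rotations of `π`,
i.e. the multiset-valued cyclic statistic induced by `st`, evaluated at `[π]`. -/
def cycStat {A : Type*} (st : List ℕ → A) (π : List ℕ) : Multiset A :=
  (Multiset.range π.length).map fun i => st (π.rotate i)

/-- `τ` is a (linear) shuffle of `π` and `σ`. -/
def IsShuffle (π σ τ : List ℕ) : Prop :=
  π.Sublist τ ∧ σ.Sublist τ ∧ τ.length = π.length + σ.length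

/-- `[τ]` is a cyclic shuffle of `[π]` and `[σ]`: some rotation of `τ` is a shuffle
of some rotation of `π` and some rotation of `σ`. -/
def IsCyclicShuffle (π σ τ : List ℕ) : Prop :=
  ∃ i j k, IsShuffle (π.rotate i) (σ.rotate j) (τ.rotate k)

/-- The set of cyclic shuffles of `[π]` and `[σ]` (as elements of `Cycle ℕ`, so that each
cyclic shuffle is counted once) on which the statistic `cst` takes the value `v`. -/
def cycShuffleFiber {A : Type*} (cst : List ℕ → A) (π σ : List ℕ) (v : A) : Set (Cycle ℕ) :=
  {c : Cycle ℕ | ∃ τ : List ℕ, (↑τ : Cycle ℕ) = c ∧ IsCyclicShuffle π σ τ ∧ cst τ = v}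

/-- A (rotation-invariant) statistic `cst` is cyclic shuffle-compatible if the distribution
of `cst` over the set of cyclic shuffles of `[π]` and `[σ]` (each cyclic shuffle counted
once) depends only on `cst π`, `cst σ`, `|π|` and `|σ|`. -/
def CyclicShuffleCompatible {A : Type*} (cst : List ℕ → A) : Prop :=
  ∀ π σ π' σ' : List ℕ, IsPerm π → IsPerm σ → IsPerm π' → IsPerm σ' →
    π.Disjoint σ → π'.Disjoint σ' →
    π.length = π'.length → σ.length = σ'.length →
    cst π = cst π' → cst σ = cst σ' →
    ∀ v : A, (cycShuffleFiber cst π σ v).ncard = (cycShuffleFiber cst π' σ' v).ncard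

/-- `h`-larger letters come first; equal even colors force ascents, equal odd colors descents. -/
def ColorRel (h : ℕ → ℕ) (x y : ℕ) : Prop :=
  h y < h x ∨ h x = h y ∧ if Even (h x) then x < y else y < x

lemma ColorRel.trans {h : ℕ → ℕ} {x y z : ℕ} (hxy : ColorRel h x y) (hyz : ColorRel h y z) :
    ColorRel h x z := by
  unfold ColorRel at *
  grind

lemma ColorRel.asymm {h : ℕ → ℕ} {x y : ℕ} (hxy : ColorRel h x y) : ¬ ColorRel h y x := by
  unfold ColorRel at *
  grind

lemma ColorRel.total {h : ℕ → ℕ} {x y : ℕ} (hxy : x ≠ y) : ColorRel h x y ∨ ColorRel h y x := by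
  unfold ColorRel at *
  grind

lemma ColorRel.congr {h h' : ℕ → ℕ} {x y : ℕ} (hx : h x = h' x) (hy : h y = h' y) :
    ColorRel h x y ↔ ColorRel h' x y := by
  simp [ColorRel, hx, hy]

/-- Colorings of the letters of `l` by colors below `c`, compatible with the order of `l`. -/
def colorings (c : ℕ) (l : List ℕ) : Set (ℕ → ℕ) :=
  {h | (∀ x ∈ l, h x < c) ∧ (∀ x ∉ l, h x = 0) ∧ l.Pairwise (ColorRel h)}

lemma finite_boundedFunctions (c : ℕ) (l : List ℕ) :
    {h : ℕ → ℕ | (∀ x ∈ l, h x < c) ∧ ∀ x ∉ l, h x = 0}.Finite := by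
  let f : {h : ℕ → ℕ | (∀ x ∈ l, h x < c) ∧ ∀ x ∉ l, h x = 0} → (l.toFinset → Fin c) :=
    fun h x => ⟨h.1 x, h.2.1 x (List.mem_toFinset.1 x.2)⟩
  refine Set.finite_coe_iff.1 (Finite.of_injective f fun g h e => Subtype.ext ?_)
  ext x
  by_cases hx : x ∈ l
  · exact congrArg Fin.val (congrFun e ⟨x, List.mem_toFinset.2 hx⟩)
  · rw [g.2.2 x hx, h.2.2 x hx]

lemma colorings_finite (c : ℕ) (l : List ℕ) : (colorings c l).Finite :=
  (finite_boundedFunctions c l).subset fun _ h => ⟨h.1, h.2.1⟩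

lemma ncard_colorings_zero (x : ℕ) (l : List ℕ) : (colorings 0 (x :: l)).ncard = 0 := by
  have : colorings 0 (x :: l) = ∅ := by
    refine Set.eq_empty_of_forall_notMem fun h hh => ?_
    simpa using hh.1 x
  simp [this]

lemma ncard_colorings_nil (c : ℕ) : (colorings c []).ncard = 1 := by
  have : colorings c [] = {0} := by
    ext h
    simp [colorings, funext_iff]
  simp [this]

lemma ncard_colorings_succ (c x : ℕ) (l : List ℕ) :
    (colorings (c + 1) (x :: l)).ncard =
      (colorings c (x :: l)).ncard + {h ∈ colorings (c + 1) (x :: l) | h x = c}.ncard := by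
  rw [← Set.ncard_union_eq ?_ (colorings_finite _ _)
    ((colorings_finite _ _).subset fun _ h => h.1)]
  · congr 1
    ext h
    simp only [colorings, Set.mem_union, Set.mem_ofPred_eq, List.pairwise_cons, ColorRel]
    constructor
    · rintro ⟨h1, h2, h3, h4⟩
      by_cases hx : h x = c
      · exact .inr ⟨⟨h1, h2, h3, h4⟩, hx⟩
      · refine .inl ⟨?_, h2, h3, h4⟩
        grind
    · grind
  · rw [Set.disjoint_left]
    simp only [colorings, Set.mem_ofPred_eq]
    grind

lemma ncard_colorings_head_eq {c x : ℕ} {l : List ℕ} {S : Set (ℕ → ℕ)} (hx : x ∉ l)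
    (hS : S = {h ∈ colorings (c + 1) l |
      ∀ y ∈ l, h y < c ∨ h y = c ∧ if Even c then x < y else y < x}) :
    {h ∈ colorings (c + 1) (x :: l) | h x = c}.ncard = S.ncard := by
  subst hS
  refine Set.ncard_congr (fun h _ => Function.update h x 0) ?_ ?_ ?_
  · rintro h ⟨⟨h1, h2, h3⟩, h4⟩
    rw [List.pairwise_cons] at h3
    have e : ∀ y ∈ l, Function.update h x 0 y = h y := fun y hy =>
      Function.update_of_ne (by rintro rfl; exact hx hy) _ _
    refine ⟨⟨?_, ?_, ?_⟩, ?_⟩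
    · intro y hy
      rw [e y hy]
      exact h1 y (by simp [hy])
    · intro y hy
      by_cases hyx : y = x
      · simp [hyx]
      · rw [Function.update_of_ne hyx]
        exact h2 y (by simp [hy, hyx])
    · exact h3.2.imp_of_mem fun {a b} ha hb hab => (ColorRel.congr (e a ha) (e b hb)).2 hab
    · intro y hy
      rw [e y hy]
      have := h3.1 y hy
      simp only [ColorRel, h4] at this
      grind
  · rintro g h ⟨_, hg⟩ ⟨_, hh⟩ e
    ext y
    by_cases hyx : y = x
    · rw [hyx, hg, hh]
    · simpa [hyx] using congrFun e y
  · rintro h ⟨⟨h1, h2, h3⟩, h4⟩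
    have e : ∀ y ∈ l, Function.update h x c y = h y := fun y hy =>
      Function.update_of_ne (by rintro rfl; exact hx hy) _ _
    refine ⟨Function.update h x c, ⟨⟨?_, ?_, ?_⟩, by simp⟩, ?_⟩
    · intro y hy
      rcases List.mem_cons.1 hy with rfl | hy
      · simp
      · rw [e y hy]
        exact h1 y hy
    · intro y hy
      rw [List.mem_cons, not_or] at hy
      rw [Function.update_of_ne hy.1]
      exact h2 y hy.2
    · rw [List.pairwise_cons]
      refine ⟨fun y hy => ?_,
        h3.imp_of_mem fun {a b} ha hb hab => (ColorRel.congr (e a ha) (e b hb)).2 hab⟩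
      have := h4 y hy
      simp only [ColorRel, e y hy, Function.update_self]
      grind
    · ext y
      by_cases hyx : y = x
      · rw [hyx, Function.update_self, h2 x hx]
      · simp [hyx]

lemma ncard_colorings_singleton (c x : ℕ) :
    (colorings (c + 1) [x]).ncard = (colorings c [x]).ncard + 1 := by
  rw [ncard_colorings_succ, ncard_colorings_head_eq (by simp) rfl]
  simp [ncard_colorings_nil]

lemma ncard_colorings_cons_cons {c x y : ℕ} {l : List ℕ} (hx : x ∉ y :: l) :
    (colorings (c + 1) (x :: y :: l)).ncard = (colorings c (x :: y :: l)).ncard +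
      if (if Even c then x < y else y < x) then (colorings (c + 1) (y :: l)).ncard
      else (colorings c (y :: l)).ncard := by
  rw [ncard_colorings_succ]
  congr 1
  split_ifs with hc <;> apply ncard_colorings_head_eq hx
  all_goals
    ext h
    simp only [colorings, Set.mem_ofPred_eq, List.pairwise_cons, ColorRel]
    grind

/-- The number of interior (non-cyclic) peaks of `l`. -/
def linPk (l : List ℕ) : ℕ :=
  ∑ i ∈ Finset.range (l.length - 2),
    if l.getD i 0 < l.getD (i + 1) 0 ∧ l.getD (i + 2) 0 < l.getD (i + 1) 0 then 1 else 0

lemma linPk_cons_cons_cons (x y z : ℕ) (l : List ℕ) :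
    linPk (x :: y :: z :: l) = linPk (y :: z :: l) + if x < y ∧ z < y then 1 else 0 := by
  simp only [linPk, List.length_cons, Nat.reduceSubDiff]
  rw [Finset.sum_range_succ']
  simp only [List.getD_cons_succ, List.getD_cons_zero]

open PowerSeries in
/-- Generating function of the number of colorings with `2 * m` colors. -/
noncomputable def evenSeries (l : List ℕ) : PowerSeries ℚ :=
  PowerSeries.mk fun m => ((colorings (2 * m) l).ncard : ℚ)

open PowerSeries in
/-- Generating function of the number of colorings with `2 * m + 1` colors. -/
noncomputable def oddSeries (l : List ℕ) : PowerSeries ℚ :=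
  PowerSeries.mk fun m => ((colorings (2 * m + 1) l).ncard : ℚ)

open PowerSeries in
lemma series_singleton (x : ℕ) :
    oddSeries [x] = evenSeries [x] + PowerSeries.mk (fun _ => 1) ∧
      evenSeries [x] = X * (oddSeries [x] + PowerSeries.mk fun _ => 1) := by
  constructor
  · ext m
    simp [evenSeries, oddSeries, ncard_colorings_singleton]
  · ext m
    cases m with
    | zero => simp [evenSeries, ncard_colorings_zero]
    | succ m =>
      rw [coeff_succ_X_mul]
      simp [evenSeries, oddSeries, mul_add, ncard_colorings_singleton]

open PowerSeries in
lemma series_ascent {x y : ℕ} {l : List ℕ} (hx : x ∉ y :: l) (hxy : x < y) :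
    oddSeries (x :: y :: l) = evenSeries (x :: y :: l) + oddSeries (y :: l) ∧
      evenSeries (x :: y :: l) = X * (oddSeries (x :: y :: l) + oddSeries (y :: l)) := by
  constructor
  · ext m
    simp [evenSeries, oddSeries, ncard_colorings_cons_cons hx, hxy]
  · ext m
    cases m with
    | zero => simp [evenSeries, ncard_colorings_zero]
    | succ m =>
      rw [coeff_succ_X_mul]
      simp [evenSeries, oddSeries, mul_add, ncard_colorings_cons_cons (c := 2 * m + 1) hx, hxy.not_gt]

open PowerSeries in
lemma series_descent {x y : ℕ} {l : List ℕ} (hx : x ∉ y :: l) (hxy : y < x) :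
    oddSeries (x :: y :: l) = evenSeries (x :: y :: l) + evenSeries (y :: l) ∧
      evenSeries (x :: y :: l) = X * oddSeries (x :: y :: l) + evenSeries (y :: l) := by
  constructor
  · ext m
    simp [evenSeries, oddSeries, ncard_colorings_cons_cons hx, hxy.not_gt]
  · ext m
    cases m with
    | zero => simp [evenSeries, ncard_colorings_zero]
    | succ m =>
      rw [map_add, coeff_succ_X_mul]
      simp [evenSeries, oddSeries, mul_add, ncard_colorings_cons_cons (c := 2 * m + 1) hx, hxy]

open PowerSeries in
lemma evenSeries_mul_aux (l : List ℕ) : ∀ x : ℕ, (x :: l).Nodup →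
    evenSeries (x :: l) * ((1 - X) ^ (l.length + 2) * (1 + X) ^ (2 * linPk (x :: l))) =
        2 * X * (4 * X) ^ linPk (x :: l) * (1 + X) ^ l.length ∧
      if ∃ y ∈ l.head?, y < x then (1 + X) * oddSeries (x :: l) = 2 * evenSeries (x :: l)
      else (1 + X) * evenSeries (x :: l) = 2 * X * oddSeries (x :: l) := by
  induction l with
  | nil =>
    intro x _
    obtain ⟨h1, h2⟩ := series_singleton x
    have h3 : (PowerSeries.mk fun _ => 1 : PowerSeries ℚ) * (1 - X) = 1 :=
      PowerSeries.mk_one_mul_one_sub_eq_one ℚ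
    generalize (PowerSeries.mk fun _ => 1 : PowerSeries ℚ) = u at *
    constructor
    · simp [linPk]
      linear_combination (1 - X) * h2 + (1 - X) * X * h1 + 2 * X * h3
    · simp
      linear_combination h2 - X * h1
  | cons y l ih =>
    intro x hl
    have hx : x ∉ y :: l := (List.nodup_cons.1 hl).1
    obtain ⟨ih1, ih2⟩ := ih y (List.nodup_cons.1 hl).2
    have hne : x ≠ y := by rintro rfl; simp at hx
    rcases hne.lt_or_gt with hxy | hxy
    · obtain ⟨h1, h2⟩ := series_ascent hx hxy
      rw [if_neg (by simpa using hxy.le)]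
      refine ⟨?_, by linear_combination h2 - X * h1⟩
      cases l with
      | nil =>
        simp only [List.head?_nil, linPk] at *
        simp at ih1 ih2 ⊢
        linear_combination (1 - X) ^ 2 * h2 + (1 - X) ^ 2 * X * h1 - (1 - X) ^ 2 * ih2
          + (1 + X) * ih1
      | cons z l =>
        by_cases hz : z < y
        · rw [if_pos (by simpa using hz)] at ih2
          rw [linPk_cons_cons_cons, if_pos ⟨hxy, hz⟩]
          simp only [List.length_cons] at *
          generalize linPk (y :: z :: l) = p at *
          have key : (1 - X) * (1 + X) * evenSeries (x :: y :: z :: l)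
              = 4 * X * evenSeries (y :: z :: l) := by
            linear_combination (1 + X) * h2 + (1 + X) * X * h1 + 2 * X * ih2
          linear_combination (1 - X) ^ (l.length + 3) * (1 + X) ^ (2 * p + 1) * key
            + 4 * X * (1 + X) * ih1
        · rw [if_neg (by simpa using hz)] at ih2
          rw [linPk_cons_cons_cons, if_neg (by simp [hz])]
          simp only [List.length_cons, add_zero] at *
          generalize linPk (y :: z :: l) = p at *
          have key : (1 - X) * evenSeries (x :: y :: z :: l)
              = (1 + X) * evenSeries (y :: z :: l) := by
            linear_combination h2 + X * h1 - ih2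
          linear_combination (1 - X) ^ (l.length + 3) * (1 + X) ^ (2 * p) * key
            + (1 + X) * ih1
    · obtain ⟨h1, h2⟩ := series_descent hx hxy
      rw [if_pos (by simpa using hxy)]
      refine ⟨?_, by linear_combination h1 - h2⟩
      have key : (1 - X) * evenSeries (x :: y :: l) = (1 + X) * evenSeries (y :: l) := by
        linear_combination h2 + X * h1
      have hp : linPk (x :: y :: l) = linPk (y :: l) := by
        cases l with
        | nil => simp [linPk]
        | cons z l => rw [linPk_cons_cons_cons, if_neg (by simp [hxy.le]), add_zero]
      rw [hp]
      simp only [List.length_cons]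
      linear_combination (1 - X) ^ (l.length + 2) * (1 + X) ^ (2 * linPk (y :: l)) * key
        + (1 + X) * ih1

open PowerSeries in
/-- The value of `evenSeries` on words of length `n` with `p` interior peaks. -/
noncomputable def pkSeries (n p : ℕ) : PowerSeries ℚ :=
  X ^ (p + 1) * ((2 * 4 ^ p) * (1 + X) ^ (n - 1) * ((1 - X) ^ (n + 1) * (1 + X) ^ (2 * p))⁻¹)

open PowerSeries in
lemma evenSeries_eq {l : List ℕ} (hl : l.Nodup) (h0 : l ≠ []) :
    evenSeries l = pkSeries l.length (linPk l) := by
  obtain ⟨x, l, rfl⟩ := List.exists_cons_of_ne_nil h0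
  have h := (evenSeries_mul_aux l x hl).1
  have hu : constantCoeff
      ((1 - X) ^ (l.length + 2) * (1 + X) ^ (2 * linPk (x :: l)) : PowerSeries ℚ) ≠ 0 := by
    simp
  rw [← PowerSeries.eq_mul_inv_iff_mul_eq hu] at h
  rw [h, pkSeries]
  simp only [List.length_cons, Nat.add_sub_cancel]
  ring

lemma coeff_pkSeries_eq_zero {m n p : ℕ} (h : m ≤ p) : (pkSeries n p).coeff m = 0 :=
  PowerSeries.X_pow_dvd_iff.1 (Dvd.intro _ rfl) m (by lia)

lemma coeff_pkSeries_ne_zero (n p : ℕ) : (pkSeries n p).coeff (p + 1) ≠ 0 := by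
  rw [pkSeries]
  have h (k : ℕ) [k.AtLeastTwo] : (OfNat.ofNat k : PowerSeries ℚ) =
      PowerSeries.C (OfNat.ofNat k) :=
    (map_ofNat PowerSeries.C k).symm
  simp [PowerSeries.coeff_X_pow_mul', h]

/-- Position `i`, read modulo the length of `l`, is a cyclic peak. -/
def IsCycPeak (l : List ℕ) (i : ℕ) : Prop :=
  l.getD ((i + (l.length - 1)) % l.length) 0 < l.getD (i % l.length) 0 ∧
    l.getD ((i + 1) % l.length) 0 < l.getD (i % l.length) 0

instance (l : List ℕ) : DecidablePred (IsCycPeak l) := fun _ => inferInstanceAs (Decidable (_ ∧ _))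

lemma getD_rotate_mod (l : List ℕ) (hl : l ≠ []) (k i : ℕ) :
    (l.rotate k).getD (i % l.length) 0 = l.getD ((i + k) % l.length) 0 := by
  have h : 0 < l.length := List.length_pos_iff.2 hl
  have hi := Nat.mod_lt i h
  rw [List.getD_eq_getElem _ _ (by simpa using hi), List.getElem_rotate,
    List.getD_eq_getElem _ _ (Nat.mod_lt _ h)]
  simp

lemma isCycPeak_rotate (l : List ℕ) (hl : l ≠ []) (k i : ℕ) :
    IsCycPeak (l.rotate k) i ↔ IsCycPeak l (i + k) := by
  simp only [IsCycPeak, List.length_rotate, getD_rotate_mod l hl, add_right_comm]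

lemma isCycPeak_add_length (l : List ℕ) (i : ℕ) : IsCycPeak l (i + l.length) ↔ IsCycPeak l i := by
  simp only [IsCycPeak, add_right_comm i l.length, Nat.add_mod_right]

lemma cpk_eq_sum (l : List ℕ) :
    cpk l = ∑ i ∈ Finset.range l.length, if IsCycPeak l i then 1 else 0 := by
  rw [Finset.sum_boole, Nat.cast_id, cpk]
  symm
  refine Finset.card_nbij' (· + 1) (· - 1) ?_ ?_ ?_ ?_
  · intro i hi
    simp only [Finset.mem_coe, cPk, Finset.mem_filter, Finset.mem_range, Finset.mem_Icc] at hi ⊢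
    simp only [IsCycPeak] at hi ⊢
    refine ⟨by lia, ?_⟩
    rw [Nat.mod_eq_of_lt hi.1] at hi
    rw [show i + 1 + l.length - 2 = i + (l.length - 1) by lia, Nat.add_sub_cancel]
    exact hi.2
  · intro i hi
    simp only [Finset.mem_coe, cPk, Finset.mem_filter, Finset.mem_range, Finset.mem_Icc] at hi ⊢
    simp only [IsCycPeak] at hi ⊢
    refine ⟨by lia, ?_⟩
    rw [Nat.mod_eq_of_lt (a := i - 1) (by lia),
      show i - 1 + (l.length - 1) = i + l.length - 2 by lia, Nat.sub_add_cancel hi.1.1]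
    exact hi.2
  · intro i hi
    simp
  · intro i hi
    simp only [Finset.mem_coe, cPk, Finset.mem_filter, Finset.mem_Icc] at hi
    exact Nat.sub_add_cancel hi.1.1

lemma sum_range_add_of_periodic {n : ℕ} {f : ℕ → ℕ} (hf : ∀ i, f (i + n) = f i) (k : ℕ) :
    ∑ i ∈ Finset.range n, f (i + k) = ∑ i ∈ Finset.range n, f i := by
  induction k with
  | zero => simp
  | succ k ih =>
    rw [← ih]
    have h := Finset.sum_range_succ (fun i => f (i + k)) n
    rw [Finset.sum_range_succ', add_comm n, hf, zero_add] at h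
    simpa [add_assoc, add_comm 1] using h

lemma sum_isCycPeak_add (l : List ℕ) (k : ℕ) :
    ∑ i ∈ Finset.range l.length, (if IsCycPeak l (i + k) then 1 else 0) = cpk l := by
  rw [cpk_eq_sum]
  exact sum_range_add_of_periodic (f := fun i => if IsCycPeak l i then 1 else 0)
    (by simp [isCycPeak_add_length]) k

lemma cpk_rotate (l : List ℕ) (k : ℕ) : cpk (l.rotate k) = cpk l := by
  rcases eq_or_ne l [] with rfl | hl
  · simp
  · rw [cpk_eq_sum, ← sum_isCycPeak_add l k]
    simp [isCycPeak_rotate l hl]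

lemma IsCycPeak.not_prev {l : List ℕ} {i : ℕ} (h : IsCycPeak l i) :
    ¬ IsCycPeak l (i + (l.length - 1)) := by
  rintro ⟨-, h'⟩
  rcases l.length.eq_zero_or_pos with h0 | h0
  · simp [List.length_eq_zero_iff.1 h0] at h'
  · rw [add_assoc, Nat.sub_add_cancel h0, Nat.add_mod_right] at h'
    exact lt_asymm h' h.1

lemma cpk_eq_linPk_add {l : List ℕ} (hl : l ≠ []) :
    cpk l = linPk l + (if IsCycPeak l 0 then 1 else 0) +
      if IsCycPeak l (l.length - 1) then 1 else 0 := by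
  obtain ⟨x, l, rfl⟩ := List.exists_cons_of_ne_nil hl
  cases l with
  | nil => simp [cpk_eq_sum, linPk, IsCycPeak]
  | cons y l =>
    rw [cpk_eq_sum, List.length_cons, Finset.sum_range_succ, List.length_cons,
      Finset.sum_range_succ', Nat.add_sub_cancel, linPk]
    congr 2
    refine Finset.sum_congr rfl fun i hi => ?_
    rw [Finset.mem_range, List.length_cons, List.length_cons] at hi
    congr 1
    simp only [IsCycPeak, List.length_cons, Nat.add_sub_cancel]
    rw [show i + 1 + (l.length + 1) = i + (l.length + 1 + 1) by ring, Nat.add_mod_right,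
      Nat.mod_eq_of_lt (a := i) (by lia), Nat.mod_eq_of_lt (a := i + 1) (by lia),
      Nat.mod_eq_of_lt (a := i + 1 + 1) (by lia)]

lemma sum_linPk_rotate {l : List ℕ} (hl : l ≠ []) (F : ℕ → ℚ) :
    ∑ k ∈ Finset.range l.length, F (linPk (l.rotate k)) =
      (l.length - 2 * cpk l) * F (cpk l) + 2 * cpk l * F (cpk l - 1) := by
  have key : ∀ k, F (linPk (l.rotate k)) = F (cpk l) +
      (((if IsCycPeak l (k + 0) then 1 else 0 : ℕ) : ℚ) +
        (if IsCycPeak l (k + (l.length - 1)) then 1 else 0 : ℕ)) *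
          (F (cpk l - 1) - F (cpk l)) := by
    intro k
    have h := cpk_eq_linPk_add (l := l.rotate k) (by simpa using hl)
    simp only [cpk_rotate, List.length_rotate, isCycPeak_rotate l hl,
      add_comm _ k] at h
    have h' := IsCycPeak.not_prev (l := l) (i := k)
    rw [add_zero]
    by_cases h1 : IsCycPeak l k
    · have h2 := h' h1
      simp only [h1, h2, if_true, if_false, add_zero] at h ⊢
      simp [h]
    · by_cases h2 : IsCycPeak l (k + (l.length - 1)) <;>
      simp only [h1, h2, if_true, if_false, add_zero] at h ⊢ <;> simp [h]
  simp_rw [key]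
  rw [Finset.sum_add_distrib, ← Finset.sum_mul, Finset.sum_add_distrib, ← Nat.cast_sum,
    ← Nat.cast_sum, sum_isCycPeak_add, sum_isCycPeak_add]
  simp
  ring

lemma cpk_le_length (l : List ℕ) : cpk l ≤ l.length := by
  simpa [cpk, cPk] using Finset.card_filter_le (Finset.Icc 1 l.length) _

lemma cpk_pos {l : List ℕ} (hl : l.Nodup) (h2 : 2 ≤ l.length) : 0 < cpk l := by
  obtain ⟨i, hi, hmax⟩ := Finset.exists_max_image (Finset.range l.length) (fun i => l.getD i 0)
    ⟨0, by simp; lia⟩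
  rw [Finset.mem_range] at hi
  have key : ∀ d, 0 < d → d < l.length →
      l.getD ((i + d) % l.length) 0 < l.getD (i % l.length) 0 := by
    intro d hd hd'
    have hlt := Nat.mod_lt (i + d) (by lia : 0 < l.length)
    have h := hmax ((i + d) % l.length) (Finset.mem_range.2 hlt)
    rw [Nat.mod_eq_of_lt hi]
    refine lt_of_le_of_ne h fun e => ?_
    rw [List.getD_eq_getElem _ _ hi, List.getD_eq_getElem _ _ hlt, hl.getElem_inj_iff] at e
    rcases lt_or_ge (i + d) l.length with h' | h'
    · rw [Nat.mod_eq_of_lt h'] at e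
      lia
    · rw [Nat.mod_eq_sub_mod h', Nat.mod_eq_of_lt (by lia)] at e
      lia
  rw [cpk_eq_sum]
  refine Finset.sum_pos' (fun _ _ => Nat.zero_le _) ⟨i, Finset.mem_range.2 hi, ?_⟩
  rw [if_pos ⟨key _ (by lia) (by lia), key _ (by lia) (by lia)⟩]
  exact one_pos

lemma List.IsRotated.filter {α : Type*} {l l' : List α} (h : l ~r l') (p : α → Bool) :
    l.filter p ~r l'.filter p := by
  obtain ⟨k, rfl⟩ := h
  conv_lhs => rw [← List.take_append_drop (k % l.length) l]
  rw [List.rotate_eq_drop_append_take_mod, List.filter_append, List.filter_append]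
  exact List.isRotated_append

lemma isCyclicShuffle_iff {π σ τ : List ℕ} (hπ : π.Nodup) (hσ : σ.Nodup) (hd : π.Disjoint σ) :
    IsCyclicShuffle π σ τ ↔
      τ.Perm (π ++ σ) ∧ τ.filter (· ∈ π) ~r π ∧ τ.filter (· ∈ σ) ~r σ := by
  have key : ∀ (ρ υ τ' : List ℕ), (∀ x ∈ υ, x ∉ ρ) → ∀ i, (ρ.rotate i).Sublist τ' →
      τ'.Perm (ρ ++ υ) → τ'.filter (· ∈ ρ) = ρ.rotate i := by
    intro ρ υ τ' hdisj i hs hp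
    have h := hs.filter (· ∈ ρ)
    rw [List.filter_eq_self.2 (by simp)] at h
    refine (h.eq_of_length ?_).symm
    rw [(hp.filter _).length_eq, List.filter_append, List.filter_eq_self.2 (by simp),
      List.filter_eq_nil_iff.2 (by simpa using hdisj)]
    simp
  constructor
  · rintro ⟨i, j, k, h1, h2, h3⟩
    have hperm : (τ.rotate k).Perm (π ++ σ) := by
      have hnd : (π.rotate i ++ σ.rotate j).Nodup := by
        rw [List.nodup_append']
        refine ⟨List.nodup_rotate.2 hπ, List.nodup_rotate.2 hσ, fun x hx hx' => ?_⟩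
        exact hd (List.mem_rotate.1 hx) (List.mem_rotate.1 hx')
      have hsub : (π.rotate i ++ σ.rotate j).Subperm (τ.rotate k) := by
        refine hnd.subperm fun x hx => ?_
        rcases List.mem_append.1 hx with hx | hx
        · exact h1.subset hx
        · exact h2.subset hx
      refine (hsub.perm_of_length_le (by simp [h3])).symm.trans ?_
      exact (List.rotate_perm _ _).append (List.rotate_perm _ _)
    have e1 := key π σ _ (fun x hx hx' => hd hx' hx) i h1 hperm
    have e2 := key σ π _ (fun x hx hx' => hd hx hx') j h2 (hperm.trans List.perm_append_comm)
    refine ⟨(List.rotate_perm τ k).symm.trans hperm, ?_, ?_⟩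
    · exact ((List.IsRotated.forall τ k).symm.filter _).trans
        (e1 ▸ List.IsRotated.forall π i)
    · exact ((List.IsRotated.forall τ k).symm.filter _).trans
        (e2 ▸ List.IsRotated.forall σ j)
  · rintro ⟨hp, h1, h2⟩
    obtain ⟨i, hi⟩ := h1.symm
    obtain ⟨j, hj⟩ := h2.symm
    refine ⟨i, j, 0, ?_, ?_, ?_⟩
    · rw [hi, List.rotate_zero]
      exact List.filter_sublist
    · rw [hj, List.rotate_zero]
      exact List.filter_sublist
    · simp [hp.length_eq]

lemma IsCyclicShuffle.of_isRotated {π σ τ τ' : List ℕ} (h : IsCyclicShuffle π σ τ)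
    (hτ : τ ~r τ') : IsCyclicShuffle π σ τ' := by
  obtain ⟨i, j, k, h⟩ := h
  obtain ⟨k', hk'⟩ := hτ.symm.trans (List.IsRotated.forall τ k).symm
  exact ⟨i, j, k', hk' ▸ h⟩

lemma IsCyclicShuffle.symm {π σ τ : List ℕ} (h : IsCyclicShuffle π σ τ) :
    IsCyclicShuffle σ π τ := by
  obtain ⟨i, j, k, h1, h2, h3⟩ := h
  exact ⟨j, i, k, h2, h1, h3.trans (add_comm _ _)⟩

/-- The set of cyclic shuffles of `π` and `σ`. -/
def cycShuffles (π σ : List ℕ) : Set (Cycle ℕ) :=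
  {s | ∃ τ : List ℕ, (τ : Cycle ℕ) = s ∧ IsCyclicShuffle π σ τ}

lemma coe_mem_cycShuffles {π σ τ : List ℕ} :
    (τ : Cycle ℕ) ∈ cycShuffles π σ ↔ IsCyclicShuffle π σ τ :=
  ⟨fun ⟨_, h, h'⟩ => h'.of_isRotated (Cycle.coe_eq_coe.1 h), fun h => ⟨τ, rfl, h⟩⟩

lemma cycShuffles_finite {π σ : List ℕ} (hπ : π.Nodup) (hσ : σ.Nodup) (hd : π.Disjoint σ) :
    (cycShuffles π σ).Finite := by
  refine (((π ++ σ).permutations.toFinset.finite_toSet).image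
    (fun l : List ℕ => (l : Cycle ℕ))).subset ?_
  rintro _ ⟨τ, rfl, h⟩
  exact ⟨τ, by simpa using ((isCyclicShuffle_iff hπ hσ hd).1 h).1, rfl⟩

/-- Colorings compatible with some representative of the cycle `s`. -/
def cycColorings (c : ℕ) (s : Cycle ℕ) : Set (ℕ → ℕ) :=
  {h | ∃ l : List ℕ, (l : Cycle ℕ) = s ∧ h ∈ colorings c l}

lemma eq_of_perm_of_colorRel {h : ℕ → ℕ} {l l' : List ℕ} (hp : l.Perm l')
    (hl : l.Pairwise (ColorRel h)) (hl' : l'.Pairwise (ColorRel h)) : l = l' :=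
  hp.eq_of_pairwise (fun _ _ _ _ h1 h2 => absurd h2 h1.asymm) hl hl'

lemma cycColorings_finite (c : ℕ) (l : List ℕ) : (cycColorings c (l : Cycle ℕ)).Finite := by
  refine (finite_boundedFunctions c l).subset ?_
  rintro h ⟨l', hl', h1, h2, -⟩
  have hm : ∀ x, x ∈ l ↔ x ∈ l' := fun x => (Cycle.coe_eq_coe.1 hl').symm.mem_iff
  exact ⟨fun x hx => h1 x ((hm x).1 hx), fun x hx => h2 x (mt (hm x).2 hx)⟩

lemma ncard_biUnion_eq_sum {ι α : Type*} (t : Finset ι) (S : ι → Set α)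
    (hS : ∀ i ∈ t, (S i).Finite)
    (hd : ∀ i ∈ t, ∀ j ∈ t, ∀ x, x ∈ S i → x ∈ S j → i = j) :
    (⋃ i ∈ t, S i).ncard = ∑ i ∈ t, (S i).ncard := by
  classical
  induction t using Finset.induction_on with
  | empty => simp
  | insert a t ha ih =>
    have hfin : (⋃ i ∈ t, S i).Finite :=
      t.finite_toSet.biUnion fun i hi => hS i (Finset.mem_insert_of_mem hi)
    rw [Finset.set_biUnion_insert, Finset.sum_insert ha, ← ih
      (fun i hi => hS i (Finset.mem_insert_of_mem hi)) fun i hi j hj =>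
        hd i (Finset.mem_insert_of_mem hi) j (Finset.mem_insert_of_mem hj)]
    refine Set.ncard_union_eq ?_ (hS a (Finset.mem_insert_self a t)) hfin
    rw [Set.disjoint_left]
    intro x hx hx'
    simp only [Set.mem_iUnion] at hx'
    obtain ⟨i, hi, hx'⟩ := hx'
    exact ha (hd a (Finset.mem_insert_self a t) i (Finset.mem_insert_of_mem hi) x hx hx' ▸ hi)

lemma ncard_cycColorings_coe (c : ℕ) {l : List ℕ} (hl : l.Nodup) (h0 : l ≠ []) :
    (cycColorings c (l : Cycle ℕ)).ncard =
      ∑ k ∈ Finset.range l.length, (colorings c (l.rotate k)).ncard := by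
  rw [← ncard_biUnion_eq_sum _ _ fun k _ => colorings_finite c (l.rotate k)]
  · congr 1
    ext h
    simp only [Set.mem_iUnion, Finset.mem_range, exists_prop]
    constructor
    · rintro ⟨l', hl', h⟩
      obtain ⟨k, rfl⟩ := Cycle.coe_eq_coe.1 hl'.symm
      exact ⟨k % l.length, Nat.mod_lt _ (List.length_pos_iff.2 h0), by rwa [List.rotate_mod]⟩
    · rintro ⟨k, -, h⟩
      exact ⟨_, Cycle.coe_eq_coe.2 (List.IsRotated.forall l k), h⟩
  · intro i hi j hj h hi' hj'
    have := eq_of_perm_of_colorRel ((List.rotate_perm l i).trans (List.rotate_perm l j).symm)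
      hi'.2.2 hj'.2.2
    rw [hl.rotate_congr_iff] at this
    simpa [h0, Nat.mod_eq_of_lt (Finset.mem_range.1 hi),
      Nat.mod_eq_of_lt (Finset.mem_range.1 hj)] using this

/-- The restriction of `h` to the letters of `l`, extended by zero. -/
def restrictTo (l : List ℕ) (h : ℕ → ℕ) (x : ℕ) : ℕ := if x ∈ l then h x else 0

lemma restrictTo_of_mem {l : List ℕ} {x : ℕ} (h : ℕ → ℕ) (hx : x ∈ l) : restrictTo l h x = h x :=
  if_pos hx

lemma restrictTo_of_notMem {l : List ℕ} {x : ℕ} (h : ℕ → ℕ) (hx : x ∉ l) :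
    restrictTo l h x = 0 :=
  if_neg hx

lemma restrictTo_mem_cycColorings {c : ℕ} {h : ℕ → ℕ} {π τ : List ℕ}
    (hτ : h ∈ colorings c τ) (hr : τ.filter (· ∈ π) ~r π) :
    restrictTo π h ∈ cycColorings c (π : Cycle ℕ) := by
  have hm : ∀ x, x ∈ τ.filter (· ∈ π) ↔ x ∈ π := fun x => hr.mem_iff
  refine ⟨_, Cycle.coe_eq_coe.2 hr, fun x hx => ?_, fun x hx => ?_, ?_⟩
  · rw [restrictTo_of_mem h ((hm x).1 hx)]
    exact hτ.1 x (List.mem_of_mem_filter hx)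
  · exact restrictTo_of_notMem h (mt (hm x).2 hx)
  · refine (hτ.2.2.sublist List.filter_sublist).imp_of_mem fun {a b} ha hb hab => ?_
    exact (ColorRel.congr (restrictTo_of_mem h ((hm a).1 ha))
      (restrictTo_of_mem h ((hm b).1 hb))).2 hab

lemma exists_perm_pairwise_colorRel (h : ℕ → ℕ) {l : List ℕ} (hl : l.Nodup) :
    ∃ l' : List ℕ, l'.Perm l ∧ l'.Pairwise (ColorRel h) := by
  classical
  let r : ℕ → ℕ → Prop := fun x y => x = y ∨ ColorRel h x y
  have : Std.Total r := ⟨fun x y => by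
    by_cases e : x = y
    · exact .inl (.inl e)
    · exact (ColorRel.total e).imp .inr .inr⟩
  have : IsTrans ℕ r := ⟨fun x y z hxy hyz => by
    rcases hxy with rfl | hxy
    · exact hyz
    · rcases hyz with rfl | hyz
      · exact .inr hxy
      · exact .inr (hxy.trans hyz)⟩
  refine ⟨l.insertionSort r, List.perm_insertionSort r l, ?_⟩
  have hnd : (l.insertionSort r).Nodup := (List.perm_insertionSort r l).nodup_iff.2 hl
  exact (List.Pairwise.and (List.pairwise_insertionSort r l) hnd).imp fun hab =>
    hab.1.resolve_left hab.2

lemma sum_ncard_cycColorings {π σ : List ℕ} (hπ : π.Nodup) (hσ : σ.Nodup) (hd : π.Disjoint σ)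
    (c : ℕ) :
    ∑ s ∈ (cycShuffles_finite hπ hσ hd).toFinset, (cycColorings c s).ncard =
      (cycColorings c (π : Cycle ℕ)).ncard * (cycColorings c (σ : Cycle ℕ)).ncard := by
  have hnd : (π ++ σ).Nodup := by
    rw [List.nodup_append']
    exact ⟨hπ, hσ, hd⟩
  have hrel : ∀ {h : ℕ → ℕ} {s : Cycle ℕ}, s ∈ cycShuffles π σ → h ∈ cycColorings c s →
      ∃ τ : List ℕ, (τ : Cycle ℕ) = s ∧ h ∈ colorings c τ ∧ τ.Perm (π ++ σ) ∧
        τ.filter (· ∈ π) ~r π ∧ τ.filter (· ∈ σ) ~r σ := by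
    rintro h s hs ⟨τ, rfl, hτ⟩
    exact ⟨τ, rfl, hτ, (isCyclicShuffle_iff hπ hσ hd).1 (coe_mem_cycShuffles.1 hs)⟩
  rw [← ncard_biUnion_eq_sum, ← Set.ncard_prod]
  · refine Set.ncard_congr (fun h _ => (restrictTo π h, restrictTo σ h)) ?_ ?_ ?_
    · intro h hh
      simp only [Set.mem_iUnion, Set.Finite.mem_toFinset, exists_prop] at hh
      obtain ⟨s, hs, hh⟩ := hh
      obtain ⟨τ, -, hτ, -, h1, h2⟩ := hrel hs hh
      exact ⟨restrictTo_mem_cycColorings hτ h1, restrictTo_mem_cycColorings hτ h2⟩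
    · intro g h hg hh e
      simp only [Set.mem_iUnion, Set.Finite.mem_toFinset, exists_prop] at hg hh
      obtain ⟨s, hs, hg⟩ := hg
      obtain ⟨t, ht, hh⟩ := hh
      obtain ⟨τ, -, hτ, hp, -⟩ := hrel hs hg
      obtain ⟨υ, -, hυ, hq, -⟩ := hrel ht hh
      rw [Prod.mk.injEq] at e
      ext x
      by_cases hx : x ∈ π
      · simpa [restrictTo, hx] using congrFun e.1 x
      · by_cases hx' : x ∈ σ
        · simpa [restrictTo, hx'] using congrFun e.2 x
        · rw [hτ.2.1 x (by simp [hp.mem_iff, hx, hx']), hυ.2.1 x (by simp [hq.mem_iff, hx, hx'])]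
    · rintro ⟨f, g⟩ ⟨⟨l, hl, hf⟩, ⟨l', hl', hg⟩⟩
      rw [Cycle.coe_eq_coe] at hl hl'
      let h : ℕ → ℕ := fun x => f x + g x
      have f0 : ∀ x ∉ π, f x = 0 := fun x hx => hf.2.1 x (mt hl.mem_iff.1 hx)
      have g0 : ∀ x ∉ σ, g x = 0 := fun x hx => hg.2.1 x (mt hl'.mem_iff.1 hx)
      have hhf : ∀ x ∈ π, h x = f x := fun x hx => by
        simp [h, g0 x fun hx' => hd hx hx']
      have hhg : ∀ x ∈ σ, h x = g x := fun x hx => by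
        simp [h, f0 x fun hx' => hd hx' hx]
      obtain ⟨τ, hp, hτ⟩ := exists_perm_pairwise_colorRel h hnd
      have e1 : τ.filter (· ∈ π) = l := by
        refine eq_of_perm_of_colorRel (h := h) ?_ (hτ.sublist List.filter_sublist) ?_
        · refine (hp.filter _).trans ?_
          rw [List.filter_append, List.filter_eq_self.2 (by simp),
            List.filter_eq_nil_iff.2 fun x hx hx' => hd (by simpa using hx') hx,
            List.append_nil]
          exact hl.perm.symm
        · exact hf.2.2.imp_of_mem fun {a b} ha hb hab =>
            (ColorRel.congr (hhf a (hl.mem_iff.1 ha)) (hhf b (hl.mem_iff.1 hb))).2 hab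
      have e2 : τ.filter (· ∈ σ) = l' := by
        refine eq_of_perm_of_colorRel (h := h) ?_ (hτ.sublist List.filter_sublist) ?_
        · refine (hp.filter _).trans ?_
          have hπσ : π.filter (· ∈ σ) = [] :=
            List.filter_eq_nil_iff.2 fun x hx hx' => hd hx (by simpa using hx')
          rw [List.filter_append, hπσ, List.nil_append, List.filter_eq_self.2 (by simp)]
          exact hl'.perm.symm
        · exact hg.2.2.imp_of_mem fun {a b} ha hb hab =>
            (ColorRel.congr (hhg a (hl'.mem_iff.1 ha)) (hhg b (hl'.mem_iff.1 hb))).2 hab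
      refine ⟨h, ?_, ?_⟩
      · simp only [Set.mem_iUnion, Set.Finite.mem_toFinset, exists_prop]
        refine ⟨τ, coe_mem_cycShuffles.2 ((isCyclicShuffle_iff hπ hσ hd).2
          ⟨hp, e1 ▸ hl, e2 ▸ hl'⟩), τ, rfl, fun x hx => ?_, fun x hx => ?_, hτ⟩
        · rcases List.mem_append.1 (hp.mem_iff.1 hx) with hx | hx
          · rw [hhf x hx]
            exact hf.1 x (hl.mem_iff.2 hx)
          · rw [hhg x hx]
            exact hg.1 x (hl'.mem_iff.2 hx)
        · rw [hp.mem_iff, List.mem_append, not_or] at hx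
          simp [h, f0 x hx.1, g0 x hx.2]
      · ext x
        · change restrictTo π h x = f x
          by_cases hx : x ∈ π
          · rw [restrictTo_of_mem _ hx, hhf x hx]
          · rw [restrictTo_of_notMem _ hx, f0 x hx]
        · change restrictTo σ h x = g x
          by_cases hx : x ∈ σ
          · rw [restrictTo_of_mem _ hx, hhg x hx]
          · rw [restrictTo_of_notMem _ hx, g0 x hx]
  · intro s hs
    obtain ⟨τ, rfl, -⟩ := (Set.Finite.mem_toFinset _).1 hs
    exact cycColorings_finite c τ
  · intro s hs t ht h hh hh'
    obtain ⟨τ, rfl, hτ, hp, -⟩ := hrel ((Set.Finite.mem_toFinset _).1 hs) hh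
    obtain ⟨υ, rfl, hυ, hq, -⟩ := hrel ((Set.Finite.mem_toFinset _).1 ht) hh'
    rw [eq_of_perm_of_colorRel (hp.trans hq.symm) hτ.2.2 hυ.2.2]

/-- The number of cyclic colorings with `2 * m` colors of a cycle of length `n` with `v` peaks. -/
noncomputable def cycWeight (n v m : ℕ) : ℚ :=
  (n - 2 * v) * (pkSeries n v).coeff m + 2 * v * (pkSeries n (v - 1)).coeff m

lemma ncard_cycColorings_eq_cycWeight {l : List ℕ} (hl : l.Nodup) (h0 : l ≠ []) (m : ℕ) :
    ((cycColorings (2 * m) (l : Cycle ℕ)).ncard : ℚ) = cycWeight l.length (cpk l) m := by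
  rw [ncard_cycColorings_coe _ hl h0, cycWeight,
    ← sum_linPk_rotate h0 fun p => (pkSeries l.length p).coeff m, Nat.cast_sum]
  refine Finset.sum_congr rfl fun k _ => ?_
  have h := evenSeries_eq (List.nodup_rotate.2 hl : (l.rotate k).Nodup) (by simpa using h0)
  rw [List.length_rotate] at h
  rw [← h, evenSeries, PowerSeries.coeff_mk]

lemma cycWeight_eq_zero {n v m : ℕ} (h : m < v) : cycWeight n v m = 0 := by
  rw [cycWeight, coeff_pkSeries_eq_zero h.le, coeff_pkSeries_eq_zero (by lia)]
  simp

lemma cycWeight_self_ne_zero (n : ℕ) {v : ℕ} (h : 0 < v) : cycWeight n v v ≠ 0 := by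
  have h' := coeff_pkSeries_ne_zero n (v - 1)
  rw [Nat.sub_add_cancel h] at h'
  rw [cycWeight, coeff_pkSeries_eq_zero le_rfl, mul_zero, zero_add]
  have : (v : ℚ) ≠ 0 := by exact_mod_cast h.ne'
  positivity

/-- The cyclic peak number of a cycle. -/
def cycleCpk : Cycle ℕ → ℕ :=
  Quotient.lift cpk (by rintro l _ ⟨k, rfl⟩; exact (cpk_rotate l k).symm)

lemma cycShuffleFiber_cpk (π σ : List ℕ) (v : ℕ) :
    cycShuffleFiber cpk π σ v = {s ∈ cycShuffles π σ | cycleCpk s = v} := by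
  ext s
  constructor
  · rintro ⟨τ, rfl, h, hv⟩
    exact ⟨⟨τ, rfl, h⟩, hv⟩
  · rintro ⟨⟨τ, rfl, h⟩, hv⟩
    exact ⟨τ, rfl, h, hv⟩

lemma length_of_isCyclicShuffle {π σ τ : List ℕ} (h : IsCyclicShuffle π σ τ) :
    τ.length = π.length + σ.length := by
  obtain ⟨i, j, k, -, -, h⟩ := h
  simpa using h

lemma sum_ncard_fiber_mul_cycWeight {π σ : List ℕ} (hπ : π.Nodup) (hσ : σ.Nodup)
    (hd : π.Disjoint σ) (hπ0 : π ≠ []) (hσ0 : σ ≠ []) (m : ℕ) :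
    ∑ v ∈ Finset.range (π.length + σ.length + 1),
        ((cycShuffleFiber cpk π σ v).ncard : ℚ) * cycWeight (π.length + σ.length) v m =
      cycWeight π.length (cpk π) m * cycWeight σ.length (cpk σ) m := by
  rw [← ncard_cycColorings_eq_cycWeight hπ hπ0, ← ncard_cycColorings_eq_cycWeight hσ hσ0,
    ← Nat.cast_mul, ← sum_ncard_cycColorings hπ hσ hd, Nat.cast_sum]
  have hterm : ∀ s ∈ (cycShuffles_finite hπ hσ hd).toFinset,
      cycleCpk s < π.length + σ.length + 1 ∧
      ((cycColorings (2 * m) s).ncard : ℚ) =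
        cycWeight (π.length + σ.length) (cycleCpk s) m := by
    intro s hs
    obtain ⟨τ, rfl, h⟩ := (Set.Finite.mem_toFinset _).1 hs
    have hlen := length_of_isCyclicShuffle h
    have hnd : τ.Nodup := by
      rw [((isCyclicShuffle_iff hπ hσ hd).1 h).1.nodup_iff, List.nodup_append']
      exact ⟨hπ, hσ, hd⟩
    refine ⟨?_, ?_⟩
    · rw [← hlen]
      exact Nat.lt_succ_of_le (cpk_le_length τ)
    · rw [← hlen]
      refine ncard_cycColorings_eq_cycWeight hnd ?_ m
      rintro rfl
      exact hπ0 (List.length_eq_zero_iff.1 (by simp at hlen; lia))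
  rw [Finset.sum_congr rfl fun s hs => (hterm s hs).2,
    ← Finset.sum_fiberwise_of_maps_to fun s hs => Finset.mem_range.2 (hterm s hs).1]
  refine Finset.sum_congr rfl fun v _ => ?_
  rw [Finset.sum_congr rfl fun s hs => by rw [(Finset.mem_filter.1 hs).2], Finset.sum_const,
    nsmul_eq_mul, cycShuffleFiber_cpk, ← Set.ncard_coe_finset]
  congr 3
  ext s
  simp

lemma eq_of_sum_mul_cycWeight {n : ℕ} {f g : ℕ → ℕ} (h0 : f 0 = g 0)
    (hf : ∀ v, n < v → f v = 0) (hg : ∀ v, n < v → g v = 0)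
    (h : ∀ m, ∑ v ∈ Finset.range (n + 1), (f v : ℚ) * cycWeight n v m =
      ∑ v ∈ Finset.range (n + 1), (g v : ℚ) * cycWeight n v m) (v : ℕ) : f v = g v := by
  induction v using Nat.strong_induction_on with
  | _ v ih =>
    rcases v.eq_zero_or_pos with rfl | hv
    · exact h0
    rcases lt_or_ge n v with hn | hn
    · rw [hf v hn, hg v hn]
    have h' := h v
    rw [← sub_eq_zero, ← Finset.sum_sub_distrib, Finset.sum_eq_single v] at h'
    · rw [← sub_mul, mul_eq_zero] at h'
      have := h'.resolve_right (cycWeight_self_ne_zero n hv)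
      exact_mod_cast sub_eq_zero.1 this
    · intro u _ hu
      rcases hu.lt_or_gt with hu | hu
      · rw [ih u hu, sub_self]
      · rw [cycWeight_eq_zero hu]
        simp
    · intro hv'
      exact absurd (Finset.mem_range.2 (by lia)) hv'

lemma isCyclicShuffle_nil_left {σ τ : List ℕ} : IsCyclicShuffle [] σ τ ↔ σ ~r τ := by
  constructor
  · rintro ⟨i, j, k, -, h, hlen⟩
    have e := h.eq_of_length (by simpa using hlen.symm)
    exact (List.IsRotated.forall σ j).symm.trans (e ▸ List.IsRotated.forall τ k)
  · rintro ⟨j, rfl⟩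
    exact ⟨0, j, 0, by simp, by simp, by simp⟩

lemma cycShuffleFiber_comm {A : Type*} (cst : List ℕ → A) (π σ : List ℕ) (v : A) :
    cycShuffleFiber cst π σ v = cycShuffleFiber cst σ π v := by
  ext s
  exact ⟨fun ⟨τ, h, h', h''⟩ => ⟨τ, h, h'.symm, h''⟩, fun ⟨τ, h, h', h''⟩ => ⟨τ, h, h'.symm, h''⟩⟩

lemma ncard_cycShuffleFiber_nil_left (σ : List ℕ) (v : ℕ) :
    (cycShuffleFiber cpk [] σ v).ncard = if cpk σ = v then 1 else 0 := by
  have hmem : ∀ s, s ∈ cycShuffleFiber cpk [] σ v ↔ s = (σ : Cycle ℕ) ∧ cpk σ = v := by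
    intro s
    constructor
    · rintro ⟨τ, rfl, h, hv⟩
      rw [isCyclicShuffle_nil_left] at h
      obtain ⟨k, rfl⟩ := h
      exact ⟨Cycle.coe_eq_coe.2 (List.IsRotated.forall σ k), (cpk_rotate σ k).symm.trans hv⟩
    · rintro ⟨rfl, hv⟩
      exact ⟨σ, rfl, isCyclicShuffle_nil_left.2 (List.IsRotated.refl σ), hv⟩
  split_ifs with h
  · rw [Set.ncard_eq_one]
    exact ⟨σ, by ext s; simp [hmem, h]⟩
  · have : cycShuffleFiber cpk [] σ v = ∅ := by
      ext s
      simp [hmem, h]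
    rw [this, Set.ncard_empty]

lemma cycShuffleFiber_cpk_zero {π σ : List ℕ} (hπ : π.Nodup) (hσ : σ.Nodup)
    (hd : π.Disjoint σ) (hπ0 : π ≠ []) (hσ0 : σ ≠ []) : cycShuffleFiber cpk π σ 0 = ∅ := by
  refine Set.eq_empty_of_forall_notMem ?_
  rintro _ ⟨τ, rfl, h, hv⟩
  have hlen := length_of_isCyclicShuffle h
  have hnd : τ.Nodup := by
    rw [((isCyclicShuffle_iff hπ hσ hd).1 h).1.nodup_iff, List.nodup_append']
    exact ⟨hπ, hσ, hd⟩
  have h1 := List.length_pos_iff.2 hπ0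
  have h2 := List.length_pos_iff.2 hσ0
  exact (cpk_pos hnd (by lia)).ne' hv

lemma cycShuffleFiber_cpk_of_length_lt {π σ : List ℕ} {v : ℕ} (hv : π.length + σ.length < v) :
    cycShuffleFiber cpk π σ v = ∅ := by
  refine Set.eq_empty_of_forall_notMem ?_
  rintro _ ⟨τ, rfl, h, rfl⟩
  rw [← length_of_isCyclicShuffle h] at hv
  exact hv.not_ge (cpk_le_length τ)

/-- The cyclic peak number `cpk` is cyclic shuffle-compatible. -/
theorem cpk_cyclic_shuffle_compatible : CyclicShuffleCompatible cpk := by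
  intro π σ π' σ' hπ hσ hπ' hσ' hd hd' hlπ hlσ hcπ hcσ v
  rcases eq_or_ne π [] with rfl | hπ0
  · rw [List.length_eq_zero_iff.1 (hlπ.symm.trans List.length_nil),
      ncard_cycShuffleFiber_nil_left, ncard_cycShuffleFiber_nil_left, hcσ]
  rcases eq_or_ne σ [] with rfl | hσ0
  · rw [List.length_eq_zero_iff.1 (hlσ.symm.trans List.length_nil), cycShuffleFiber_comm,
      cycShuffleFiber_comm cpk π', ncard_cycShuffleFiber_nil_left,
      ncard_cycShuffleFiber_nil_left, hcπ]
  have hπ0' : π' ≠ [] := by rwa [← List.length_pos_iff, ← hlπ, List.length_pos_iff]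
  have hσ0' : σ' ≠ [] := by rwa [← List.length_pos_iff, ← hlσ, List.length_pos_iff]
  refine eq_of_sum_mul_cycWeight (n := π.length + σ.length)
    (f := fun v => (cycShuffleFiber cpk π σ v).ncard)
    (g := fun v => (cycShuffleFiber cpk π' σ' v).ncard) ?_ ?_ ?_ ?_ v
  · simp only [cycShuffleFiber_cpk_zero hπ.1 hσ.1 hd hπ0 hσ0,
      cycShuffleFiber_cpk_zero hπ'.1 hσ'.1 hd' hπ0' hσ0']
  · intro u hu
    simp only [cycShuffleFiber_cpk_of_length_lt hu, Set.ncard_empty]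
  · intro u hu
    rw [hlπ, hlσ] at hu
    simp only [cycShuffleFiber_cpk_of_length_lt hu, Set.ncard_empty]
  · intro m
    have h := sum_ncard_fiber_mul_cycWeight hπ'.1 hσ'.1 hd' hπ0' hσ0' m
    rw [← hlπ, ← hlσ, ← hcπ, ← hcσ] at h
    rw [sum_ncard_fiber_mul_cycWeight hπ.1 hσ.1 hd hπ0 hσ0 m, h]
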